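/- Let n ≥ 5, a ≥ 0 and p > 1. There exists a constant C = C(n,p,a), independent of R, of the center x and of u, such that for every smooth stable solution u of Δ²u = |x|^a |u|^{p-1} u on ℝ^n and every ball B_R(x) ⊂ ℝ^n: ∫_{B_R(x)} ( |Δu|² + |y|^a |u|^{p+1} ) dy ≤ C R^{n − (4(p+1)+2a)/(p-1)}. -/

import Mathlib

open MeasureTheory Metric Set Filter
open scoped RealInnerProductSpace Topology

noncomputable section

/-- The Laplacian of `u : ℝⁿ → ℝ` at `x`, as the sum of the pure second
partial derivatives in the coordinate directions. -/
def lap (n : ℕ) (u : EuclideanSpace ℝ (Fin n) → ℝ) (x : EuclideanSpace ℝ (Fin n)) : ℝ :=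
  ∑ i : Fin n, iteratedFDeriv ℝ 2 u x ![EuclideanSpace.single i 1, EuclideanSpace.single i 1]

/-- `u` solves `Δ²u = |x|^a |u|^(p-1) u` pointwise on `Ω`. -/
def IsSolutionOn (n : ℕ) (a p : ℝ) (u : EuclideanSpace ℝ (Fin n) → ℝ)
    (Ω : Set (EuclideanSpace ℝ (Fin n))) : Prop :=
  ∀ x ∈ Ω, lap n (lap n u) x = ‖x‖ ^ a * |u x| ^ (p - 1) * u x

/-- `u` is a stable solution on `Ω`:
`p ∫ |x|^a |u|^(p-1) ψ² ≤ ∫ (Δψ)²` for every test function `ψ ∈ C_c^∞(Ω)`. -/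
def StableOn (n : ℕ) (a p : ℝ) (u : EuclideanSpace ℝ (Fin n) → ℝ)
    (Ω : Set (EuclideanSpace ℝ (Fin n))) : Prop :=
  ∀ ψ : EuclideanSpace ℝ (Fin n) → ℝ, ContDiff ℝ (⊤ : ℕ∞) ψ → HasCompactSupport ψ →
    tsupport ψ ⊆ Ω →
    p * ∫ x, ‖x‖ ^ a * |u x| ^ (p - 1) * ψ x ^ 2 ≤ ∫ x, lap n ψ x ^ 2

/-- Surface integral of `f` over the sphere `∂B_r(x)`, with respect to the
`(n-1)`-dimensional Hausdorff measure. -/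
def sphInt (n : ℕ) (x : EuclideanSpace ℝ (Fin n)) (r : ℝ)
    (f : EuclideanSpace ℝ (Fin n) → ℝ) : ℝ :=
  ∫ y in sphere x r, f y ∂(Measure.hausdorffMeasure ((n : ℝ) - 1))

/-- Radial derivative of `u` at `y`, relative to the center `x`. -/
def radDeriv (n : ℕ) (x : EuclideanSpace ℝ (Fin n))
    (u : EuclideanSpace ℝ (Fin n) → ℝ) (y : EuclideanSpace ℝ (Fin n)) : ℝ :=
  ⟪gradient u y, ‖y - x‖⁻¹ • (y - x)⟫

/-- `ℓ₁ = (β+2)(n-4-β) + β(n-2-β)` with `β = (4+a)/(p-1)`. -/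
def ell1 (n : ℕ) (a p : ℝ) : ℝ :=
  let β : ℝ := (4 + a) / (p - 1)
  (β + 2) * ((n : ℝ) - 4 - β) + β * ((n : ℝ) - 2 - β)

/-- `ℓ₂ = β(β+2)(n-4-β)(n-2-β)` with `β = (4+a)/(p-1)`. -/
def ell2 (n : ℕ) (a p : ℝ) : ℝ :=
  let β : ℝ := (4 + a) / (p - 1)
  β * (β + 2) * ((n : ℝ) - 4 - β) * ((n : ℝ) - 2 - β)

/-- The constant `c(n,p,a) = 2(ρ - γ - 1)`, `ρ = n-1-2β`, `γ = β(β-n+2)`. -/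
def cConst (n : ℕ) (a p : ℝ) : ℝ :=
  let β : ℝ := (4 + a) / (p - 1)
  2 * (((n : ℝ) - 1 - 2 * β) - β * (β - (n : ℝ) + 2) - 1)

/-- The rescaled energy `E(r; x, u)` from the monotonicity formula. -/
def energyE (n : ℕ) (a p : ℝ) (u : EuclideanSpace ℝ (Fin n) → ℝ)
    (x : EuclideanSpace ℝ (Fin n)) (r : ℝ) : ℝ :=
  let β : ℝ := (4 + a) / (p - 1)
  r ^ (2 * β + 4 - (n : ℝ)) *
      (∫ y in ball x r,
        (1 / 2) * lap n u y ^ 2 - (1 / (p + 1)) * ‖y‖ ^ a * |u y| ^ (p + 1))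
    + β / 2 * ((n : ℝ) - 2 - β) *
        deriv (fun ρ : ℝ => ρ ^ (2 * β + 1 - (n : ℝ)) * sphInt n x ρ fun y => u y ^ 2) r
    + β / 2 * ((n : ℝ) - 2 - β) *
        deriv (fun ρ : ℝ => ρ ^ (2 * β + 2 - (n : ℝ)) * sphInt n x ρ fun y => u y ^ 2) r
    + r ^ 3 / 2 *
        deriv (fun ρ : ℝ => ρ ^ (2 * β + 1 - (n : ℝ)) *
          sphInt n x ρ fun y => (β * ρ⁻¹ * u y + radDeriv n x u y) ^ 2) r
    + 1 / 2 *
        deriv (fun ρ : ℝ => ρ ^ (2 * β + 4 - (n : ℝ)) *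
          sphInt n x ρ fun y => ‖gradient u y‖ ^ 2 - radDeriv n x u y ^ 2) r
    + 1 / 2 * r ^ (2 * β + 3 - (n : ℝ)) *
        (sphInt n x r fun y => ‖gradient u y‖ ^ 2 - radDeriv n x u y ^ 2)

end

/-- The partial derivative of `f` in the `i`-th coordinate direction. -/
noncomputable def pd {n : ℕ} (i : Fin n) (f : EuclideanSpace ℝ (Fin n) → ℝ)
    (x : EuclideanSpace ℝ (Fin n)) : ℝ :=
  fderiv ℝ f x (EuclideanSpace.single i 1)

/-- The pointwise inner product of the gradients of `f` and `g`. -/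
noncomputable def gradDot {n : ℕ} (f g : EuclideanSpace ℝ (Fin n) → ℝ)
    (x : EuclideanSpace ℝ (Fin n)) : ℝ :=
  ∑ i, pd i f x * pd i g x

section Calculus

variable {n : ℕ} {f g : EuclideanSpace ℝ (Fin n) → ℝ}

lemma contDiff_pd (hf : ContDiff ℝ (⊤ : ℕ∞) f) (i : Fin n) :
    ContDiff ℝ (⊤ : ℕ∞) (pd i f) :=
  (hf.fderiv_right (m := (⊤ : ℕ∞)) (by simp)).clm_apply contDiff_const

lemma contDiff_gradDot (hf : ContDiff ℝ (⊤ : ℕ∞) f) (hg : ContDiff ℝ (⊤ : ℕ∞) g) :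
    ContDiff ℝ (⊤ : ℕ∞) (gradDot f g) :=
  ContDiff.sum fun i _ => (contDiff_pd hf i).mul (contDiff_pd hg i)

lemma lap_eq_sum_pd (hf : ContDiff ℝ (⊤ : ℕ∞) f) :
    lap n f = fun x => ∑ i, pd i (pd i f) x := by
  funext x
  refine Finset.sum_congr rfl fun i _ => ?_
  have hd : DifferentiableAt ℝ (fderiv ℝ f) x :=
    (hf.fderiv_right (m := (⊤ : ℕ∞)) (by simp)).differentiable (by simp) x
  rw [iteratedFDeriv_two_apply]
  simp only [pd, Matrix.cons_val_zero, Matrix.cons_val_one]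
  have h := fderiv_clm_apply hd
    (differentiableAt_const (EuclideanSpace.single i (1 : ℝ)))
  change _ = fderiv ℝ (fun y => fderiv ℝ f y (EuclideanSpace.single i 1)) x _
  rw [h]
  simp

lemma contDiff_lap (hf : ContDiff ℝ (⊤ : ℕ∞) f) : ContDiff ℝ (⊤ : ℕ∞) (lap n f) := by
  rw [lap_eq_sum_pd hf]
  exact ContDiff.sum fun i _ => contDiff_pd (contDiff_pd hf i) i

lemma pd_mul (hf : ContDiff ℝ (⊤ : ℕ∞) f) (hg : ContDiff ℝ (⊤ : ℕ∞) g) (i : Fin n) :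
    pd i (fun x => f x * g x) = fun x => f x * pd i g x + g x * pd i f x := by
  funext x
  have h := fderiv_fun_mul (hf.differentiable (by simp) x) (hg.differentiable (by simp) x)
  simp [pd, h]

lemma pd_add (hf : ContDiff ℝ (⊤ : ℕ∞) f) (hg : ContDiff ℝ (⊤ : ℕ∞) g) (i : Fin n) :
    pd i (fun x => f x + g x) = fun x => pd i f x + pd i g x := by
  funext x
  have h := fderiv_fun_add (hf.differentiable (by simp) x) (hg.differentiable (by simp) x)
  simp [pd, h]

lemma lap_mul (hf : ContDiff ℝ (⊤ : ℕ∞) f) (hg : ContDiff ℝ (⊤ : ℕ∞) g)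
    (x : EuclideanSpace ℝ (Fin n)) :
    lap n (fun x => f x * g x) x = f x * lap n g x + 2 * gradDot f g x + g x * lap n f x := by
  rw [lap_eq_sum_pd (hf.mul hg), lap_eq_sum_pd hf, lap_eq_sum_pd hg]
  simp only [gradDot, Finset.mul_sum, ← Finset.sum_add_distrib]
  refine Finset.sum_congr rfl fun i _ => ?_
  rw [pd_mul hf hg, pd_add (hf.mul (contDiff_pd hg i)) (hg.mul (contDiff_pd hf i)),
    pd_mul hf (contDiff_pd hg i), pd_mul hg (contDiff_pd hf i)]
  ring

lemma gradDot_mul_left {k : EuclideanSpace ℝ (Fin n) → ℝ} (hf : ContDiff ℝ (⊤ : ℕ∞) f)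
    (hg : ContDiff ℝ (⊤ : ℕ∞) g) (x : EuclideanSpace ℝ (Fin n)) :
    gradDot (fun x => f x * g x) k x = f x * gradDot g k x + g x * gradDot f k x := by
  simp only [gradDot, Finset.mul_sum, ← Finset.sum_add_distrib]
  refine Finset.sum_congr rfl fun i _ => ?_
  rw [pd_mul hf hg]
  ring

lemma gradDot_sq_le (x : EuclideanSpace ℝ (Fin n)) :
    gradDot f g x ^ 2 ≤ gradDot f f x * gradDot g g x := by
  simpa only [gradDot, ← pow_two] using
    Finset.sum_mul_sq_le_sq_mul_sq Finset.univ (fun i => pd i f x) (fun i => pd i g x)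

lemma hasCompactSupport_pd (hf : HasCompactSupport f) (i : Fin n) :
    HasCompactSupport (pd i f) :=
  hf.fderiv_apply ℝ _

lemma hasCompactSupport_sum {ι : Type*} {F : ι → EuclideanSpace ℝ (Fin n) → ℝ} (s : Finset ι)
    (hF : ∀ i ∈ s, HasCompactSupport (F i)) :
    HasCompactSupport fun x => ∑ i ∈ s, F i x := by
  classical
  induction s using Finset.induction_on with
  | empty =>
    simp only [Finset.sum_empty]
    exact HasCompactSupport.zero
  | insert i s hi ih =>
    simp only [Finset.sum_insert hi]
    exact (hF i (by simp)).add (ih fun j hj => hF j (by simp [hj]))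

lemma hasCompactSupport_gradDot_right (hg : HasCompactSupport g) :
    HasCompactSupport (gradDot f g) :=
  hasCompactSupport_sum _ fun i _ => (hasCompactSupport_pd hg i).mul_left

lemma hasCompactSupport_lap (hfs : ContDiff ℝ (⊤ : ℕ∞) f) (hf : HasCompactSupport f) :
    HasCompactSupport (lap n f) := by
  rw [lap_eq_sum_pd hfs]
  exact hasCompactSupport_sum _ fun i _ => hasCompactSupport_pd (hasCompactSupport_pd hf i) i

lemma integral_mul_pd (hf : ContDiff ℝ (⊤ : ℕ∞) f) (hg : ContDiff ℝ (⊤ : ℕ∞) g)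
    (hgc : HasCompactSupport g) (i : Fin n) :
    ∫ x, f x * pd i g x = -∫ x, pd i f x * g x := by
  refine integral_mul_fderiv_eq_neg_fderiv_mul_of_integrable ?_ ?_ ?_
    (fun x _ => hf.differentiable (by simp) x) (fun x _ => hg.differentiable (by simp) x)
  · exact ((contDiff_pd hf i).continuous.mul hg.continuous).integrable_of_hasCompactSupport
      hgc.mul_left
  · exact (hf.continuous.mul (contDiff_pd hg i).continuous).integrable_of_hasCompactSupport
      (hasCompactSupport_pd hgc i).mul_left
  · exact (hf.continuous.mul hg.continuous).integrable_of_hasCompactSupport hgc.mul_left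

/-- Green's second identity, for one compactly supported factor. -/
lemma integral_mul_lap (hf : ContDiff ℝ (⊤ : ℕ∞) f) (hg : ContDiff ℝ (⊤ : ℕ∞) g)
    (hgc : HasCompactSupport g) :
    ∫ x, f x * lap n g x = ∫ x, lap n f x * g x := by
  rw [lap_eq_sum_pd hf, lap_eq_sum_pd hg]
  simp only [Finset.mul_sum, Finset.sum_mul]
  rw [integral_finsetSum, integral_finsetSum]
  · refine Finset.sum_congr rfl fun i _ => ?_
    rw [integral_mul_pd hf (contDiff_pd hg i) (hasCompactSupport_pd hgc i),
      integral_mul_pd (contDiff_pd hf i) hg hgc, neg_neg]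
  · intro i _
    exact ((contDiff_pd (contDiff_pd hf i) i).continuous.mul
      hg.continuous).integrable_of_hasCompactSupport hgc.mul_left
  · intro i _
    exact (hf.continuous.mul
      (contDiff_pd (contDiff_pd hg i) i).continuous).integrable_of_hasCompactSupport
      (hasCompactSupport_pd (hasCompactSupport_pd hgc i) i).mul_left

lemma pd_comp_affine (i : Fin n) (hf : ContDiff ℝ (⊤ : ℕ∞) f) (r : ℝ)
    (c : EuclideanSpace ℝ (Fin n)) :
    pd i (fun x => f (r • (x - c))) = fun x => r * pd i f (r • (x - c)) := by
  funext x
  have h1 : HasFDerivAt (fun x : EuclideanSpace ℝ (Fin n) => r • (x - c))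
      (r • ContinuousLinearMap.id ℝ _) x := ((hasFDerivAt_id x).sub_const c).const_smul r
  have h2 := ((hf.differentiable (by simp) (r • (x - c))).hasFDerivAt).comp x h1
  have h3 : fderiv ℝ (fun x => f (r • (x - c))) x = _ := h2.fderiv
  simp [pd, h3]

lemma pd_const_mul (i : Fin n) (hf : ContDiff ℝ (⊤ : ℕ∞) f) (r : ℝ) :
    pd i (fun x => r * f x) = fun x => r * pd i f x := by
  funext x
  have h := fderiv_const_mul (hf.differentiable (by simp) x) r
  simp [pd, h]

lemma contDiff_comp_affine (hf : ContDiff ℝ (⊤ : ℕ∞) f) (r : ℝ)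
    (c : EuclideanSpace ℝ (Fin n)) :
    ContDiff ℝ (⊤ : ℕ∞) fun x => f (r • (x - c)) :=
  hf.comp ((contDiff_id.sub contDiff_const).const_smul r)

lemma lap_comp_affine (hf : ContDiff ℝ (⊤ : ℕ∞) f) (r : ℝ)
    (c x : EuclideanSpace ℝ (Fin n)) :
    lap n (fun x => f (r • (x - c))) x = r ^ 2 * lap n f (r • (x - c)) := by
  rw [lap_eq_sum_pd (contDiff_comp_affine hf r c), lap_eq_sum_pd hf]
  simp only [Finset.mul_sum]
  refine Finset.sum_congr rfl fun i _ => ?_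
  rw [pd_comp_affine i hf, pd_const_mul i (contDiff_comp_affine (contDiff_pd hf i) r c),
    pd_comp_affine i (contDiff_pd hf i)]
  ring

lemma lap_const_mul (hf : ContDiff ℝ (⊤ : ℕ∞) f) (r : ℝ) (x : EuclideanSpace ℝ (Fin n)) :
    lap n (fun x => r * f x) x = r * lap n f x := by
  rw [lap_eq_sum_pd (contDiff_const.mul hf), lap_eq_sum_pd hf]
  simp only [Finset.mul_sum]
  refine Finset.sum_congr rfl fun i _ => ?_
  rw [pd_const_mul i hf, pd_const_mul i (contDiff_pd hf i)]

lemma gradDot_comp_affine (hf : ContDiff ℝ (⊤ : ℕ∞) f) (hg : ContDiff ℝ (⊤ : ℕ∞) g) (r : ℝ)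
    (c : EuclideanSpace ℝ (Fin n)) :
    gradDot (fun x => f (r • (x - c))) (fun x => g (r • (x - c))) =
      fun x => r ^ 2 * gradDot f g (r • (x - c)) := by
  funext x
  simp only [gradDot, Finset.mul_sum]
  refine Finset.sum_congr rfl fun i _ => ?_
  rw [pd_comp_affine i hf, pd_comp_affine i hg]
  ring

lemma pd_eventuallyEq_zero {x : EuclideanSpace ℝ (Fin n)} {c : ℝ}
    (h : f =ᶠ[𝓝 x] fun _ => c) (i : Fin n) : pd i f =ᶠ[𝓝 x] fun _ => 0 := by
  filter_upwards [h.eventually_nhds] with y hy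
  have hy' : f =ᶠ[𝓝 y] fun _ => c := hy
  simp [pd, hy'.fderiv_eq]

lemma lap_eq_zero_of_eventuallyEq {x : EuclideanSpace ℝ (Fin n)} {c : ℝ}
    (hf : ContDiff ℝ (⊤ : ℕ∞) f) (h : f =ᶠ[𝓝 x] fun _ => c) : lap n f x = 0 := by
  rw [lap_eq_sum_pd hf]
  exact Finset.sum_eq_zero fun i _ =>
    (pd_eventuallyEq_zero (pd_eventuallyEq_zero h i) i).eq_of_nhds

lemma gradDot_eventuallyEq_zero {x : EuclideanSpace ℝ (Fin n)} {c : ℝ}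
    (h : g =ᶠ[𝓝 x] fun _ => c) : gradDot f g =ᶠ[𝓝 x] fun _ => 0 := by
  have := eventually_all.2 fun i : Fin n => pd_eventuallyEq_zero h i
  filter_upwards [this] with y hy
  exact Finset.sum_eq_zero fun i _ => by simp [hy i]

end Calculus

section Cutoff

variable {n : ℕ} {η F G : EuclideanSpace ℝ (Fin n) → ℝ}

/-- `F` is the product of `η ^ k` and a smooth function. -/
def SmoothDvd {n : ℕ} (η : EuclideanSpace ℝ (Fin n) → ℝ) (k : ℕ)
    (F : EuclideanSpace ℝ (Fin n) → ℝ) : Prop :=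
  ∃ H : EuclideanSpace ℝ (Fin n) → ℝ, ContDiff ℝ (⊤ : ℕ∞) H ∧ F = fun x => η x ^ k * H x

lemma SmoothDvd.mul {k l : ℕ} (hF : SmoothDvd η k F) (hG : SmoothDvd η l G) :
    SmoothDvd η (k + l) fun x => F x * G x := by
  obtain ⟨A, hA, rfl⟩ := hF
  obtain ⟨B, hB, rfl⟩ := hG
  exact ⟨fun x => A x * B x, hA.mul hB, by funext x; ring⟩

lemma SmoothDvd.sum {ι : Type*} {k : ℕ} (s : Finset ι)
    {F : ι → EuclideanSpace ℝ (Fin n) → ℝ} (hF : ∀ i, SmoothDvd η k (F i)) :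
    SmoothDvd η k fun x => ∑ i ∈ s, F i x := by
  choose A hA hFA using hF
  refine ⟨fun x => ∑ i ∈ s, A i x, ContDiff.sum fun i _ => hA i, ?_⟩
  funext x
  simp [hFA, Finset.mul_sum]

lemma SmoothDvd.pd {k : ℕ} (hη : ContDiff ℝ (⊤ : ℕ∞) η) (hF : SmoothDvd η (k + 1) F)
    (i : Fin n) : SmoothDvd η k (pd i F) := by
  obtain ⟨A, hA, rfl⟩ := hF
  have hp : _root_.pd i (fun x => η x ^ (k + 1)) =
      fun x => (k + 1) * η x ^ k * _root_.pd i η x := by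
    funext x
    have h := fderiv_fun_pow (k + 1) (hη.differentiable (by simp) x)
    simp [_root_.pd, h]
  refine ⟨fun x => η x * _root_.pd i A x + A x * ((k + 1) * _root_.pd i η x),
    (hη.mul (contDiff_pd hA i)).add (hA.mul (contDiff_const.mul (contDiff_pd hη i))), ?_⟩
  rw [pd_mul (hη.pow _) hA, hp]
  funext x
  ring

lemma SmoothDvd.contDiff {k : ℕ} (hη : ContDiff ℝ (⊤ : ℕ∞) η) (hF : SmoothDvd η k F) :
    ContDiff ℝ (⊤ : ℕ∞) F := by
  obtain ⟨A, hA, rfl⟩ := hF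
  exact (hη.pow _).mul hA

lemma SmoothDvd.lap {k : ℕ} (hη : ContDiff ℝ (⊤ : ℕ∞) η) (hF : SmoothDvd η (k + 2) F) :
    SmoothDvd η k (lap n F) := by
  rw [lap_eq_sum_pd (hF.contDiff hη)]
  exact SmoothDvd.sum _ fun i => (hF.pd hη i).pd hη i

lemma SmoothDvd.gradDot {k l : ℕ} (hη : ContDiff ℝ (⊤ : ℕ∞) η) (hF : SmoothDvd η (k + 1) F)
    (hG : SmoothDvd η (l + 1) G) : SmoothDvd η (k + l) (gradDot F G) :=
  SmoothDvd.sum _ fun i => (hF.pd hη i).mul (hG.pd hη i)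

lemma SmoothDvd.exists_bound {k : ℕ} (hk : k ≠ 0) (hη : ∀ x, 0 ≤ η x)
    (hηc : HasCompactSupport η) (hF : SmoothDvd η k F) :
    ∃ K : ℝ, 0 ≤ K ∧ ∀ x, |F x| ≤ K * η x ^ k := by
  obtain ⟨A, hA, rfl⟩ := hF
  obtain ⟨K, hK⟩ := hηc.isCompact.exists_bound_of_continuousOn hA.continuous.continuousOn
  refine ⟨max K 0, le_max_right _ _, fun x => ?_⟩
  rw [abs_mul, abs_of_nonneg (pow_nonneg (hη x) k), mul_comm]
  by_cases hx : x ∈ tsupport η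
  · exact mul_le_mul_of_nonneg_right ((hK x hx).trans (le_max_left _ _)) (pow_nonneg (hη x) k)
  · simp [image_eq_zero_of_notMem_tsupport hx, hk]

/-- A cutoff function together with bounds for the derivatives of its powers. -/
lemma exists_cutoff (n k : ℕ) (hk : k ≠ 0) :
    ∃ (η : EuclideanSpace ℝ (Fin n) → ℝ) (K : ℝ), 0 < K ∧ ContDiff ℝ (⊤ : ℕ∞) η ∧
      (∀ x, 0 ≤ η x) ∧ (∀ x, η x ≤ 1) ∧ (∀ x ∈ ball 0 1, η x = 1) ∧
      (∀ x ∉ closedBall 0 2, η x = 0) ∧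
      (∀ x, gradDot (fun x => η x ^ (k + 2)) (fun x => η x ^ (k + 2)) x ^ 2 ≤
        K * (η x ^ (k + 2)) ^ 2 * η x ^ (2 * k)) ∧
      (∀ x, lap n (fun x => η x ^ (k + 2)) x ^ 2 ≤ K * η x ^ (2 * k)) ∧
      (∀ x, lap n (gradDot (fun x => η x ^ (k + 2)) (fun x => η x ^ (k + 2))) x ≤
        K * η x ^ (2 * k)) := by
  let b : ContDiffBump (0 : EuclideanSpace ℝ (Fin n)) := ⟨1, 2, one_pos, one_lt_two⟩
  have hb : ContDiff ℝ (⊤ : ℕ∞) b := b.contDiff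
  have hb0 : ∀ x, 0 ≤ b x := fun x => b.nonneg
  have hφ : SmoothDvd b (k + 2) (fun x => b x ^ (k + 2)) :=
    ⟨fun _ => 1, contDiff_const, by simp⟩
  have hg := SmoothDvd.gradDot hb hφ hφ
  have hlg : SmoothDvd b (2 * k) _ :=
    SmoothDvd.lap hb (by rwa [show k + 1 + (k + 1) = 2 * k + 2 by ring] at hg)
  obtain ⟨K₁, hK₁, h₁⟩ := hg.exists_bound (by omega) hb0 b.hasCompactSupport
  obtain ⟨K₂, hK₂, h₂⟩ := (SmoothDvd.lap hb hφ).exists_bound hk hb0 b.hasCompactSupport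
  obtain ⟨K₃, hK₃, h₃⟩ := hlg.exists_bound (by omega) hb0 b.hasCompactSupport
  have hsq : ∀ {s t : ℝ}, |s| ≤ t → s ^ 2 ≤ t ^ 2 := fun h => by
    rw [← sq_abs]; exact pow_le_pow_left₀ (abs_nonneg _) h 2
  refine ⟨b, K₁ ^ 2 + K₂ ^ 2 + K₃ + 1, by positivity, hb, hb0, fun x => b.le_one,
    fun x hx => b.one_of_mem_closedBall (ball_subset_closedBall hx), fun x hx => ?_,
    fun x => ?_, fun x => ?_, fun x => ?_⟩
  · refine b.zero_of_le_dist ?_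
    rw [mem_closedBall, not_le] at hx
    exact hx.le
  · refine (hsq (h₁ x)).trans ?_
    have := hb0 x
    calc (K₁ * b x ^ (k + 1 + (k + 1))) ^ 2
        = K₁ ^ 2 * ((b x ^ (k + 2)) ^ 2 * b x ^ (2 * k)) := by ring
      _ ≤ (K₁ ^ 2 + K₂ ^ 2 + K₃ + 1) * ((b x ^ (k + 2)) ^ 2 * b x ^ (2 * k)) := by
        gcongr
        nlinarith
      _ = _ := by ring
  · refine (hsq (h₂ x)).trans ?_
    have := hb0 x
    calc (K₂ * b x ^ k) ^ 2 = K₂ ^ 2 * b x ^ (2 * k) := by ring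
      _ ≤ _ := by
        gcongr
        nlinarith
  · refine (le_abs_self _).trans ((h₃ x).trans ?_)
    have := hb0 x
    gcongr
    nlinarith

end Cutoff

section Energy

variable {n : ℕ} {a p : ℝ} {u φ h : EuclideanSpace ℝ (Fin n) → ℝ}

lemma abs_rpow_sub_one_mul_sq (hp : 1 < p) (t : ℝ) :
    |t| ^ (p - 1) * t ^ 2 = |t| ^ (p + 1) := by
  rw [← sq_abs t, ← Real.rpow_natCast |t| 2,
    ← Real.rpow_add_of_nonneg (abs_nonneg t) (by linarith) (by norm_num)]
  congr 1
  push_cast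
  ring

/-- Testing the equation with `u φ²` and the stability inequality with `u φ`. -/
lemma energy_le_integral_sq_mul (hp : 1 < p) {K : ℝ} (hK : 0 < K)
    (hu : ContDiff ℝ (⊤ : ℕ∞) u) (hsol : IsSolutionOn n a p u Set.univ)
    (hst : StableOn n a p u Set.univ) (hφ : ContDiff ℝ (⊤ : ℕ∞) φ)
    (hφc : HasCompactSupport φ) (hh : ∀ x, 0 ≤ h x)
    (hint : Integrable fun x => u x ^ 2 * h x)
    (h₁ : ∀ x, gradDot φ φ x ^ 2 ≤ K * φ x ^ 2 * h x)
    (h₂ : ∀ x, lap n φ x ^ 2 ≤ K * h x)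
    (h₃ : ∀ x, lap n (gradDot φ φ) x ≤ K * h x) {c : ℝ} (hc : c = (2 * p + 1) / (p - 1) + 2) :
    (∫ x, φ x ^ 2 * lap n u x ^ 2) + (∫ x, ‖x‖ ^ a * |u x| ^ (p + 1) * φ x ^ 2) ≤
      (12 * K * c + 100 * c ^ 2 * K) * ∫ x, u x ^ 2 * h x := by
  have hp' : 0 < p - 1 := by linarith
  have hc0 : 0 < c := by rw [hc]; positivity
  have hL := contDiff_lap hu
  have hg := contDiff_gradDot hφ hφ
  have hgc : HasCompactSupport (gradDot φ φ) := hasCompactSupport_gradDot_right hφc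
  have hG := contDiff_gradDot hu hφ
  have hGc : HasCompactSupport (gradDot u φ) := hasCompactSupport_gradDot_right hφc
  have hD := contDiff_lap hφ
  have hDc := hasCompactSupport_lap hφ hφc
  have huφ := hu.mul hφ
  have huφc : HasCompactSupport fun x => u x * φ x := hφc.mul_left
  have hlapuφ : ∀ x, lap n (fun x => u x * φ x) x =
      u x * lap n φ x + 2 * gradDot u φ x + φ x * lap n u x := lap_mul hu hφ
  let A : EuclideanSpace ℝ (Fin n) → ℝ := fun x => 2 * gradDot u φ x + u x * lap n φ x
  have hAcont : Continuous A :=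
    (continuous_const.mul hG.continuous).add (hu.continuous.mul hD.continuous)
  have hAc : HasCompactSupport A := HasCompactSupport.add hGc.mul_left hDc.mul_left
  have iX : Integrable fun x => φ x ^ 2 * lap n u x ^ 2 := by
    refine Continuous.integrable_of_hasCompactSupport
      ((hφ.continuous.pow 2).mul (hL.continuous.pow 2)) ?_
    simp only [pow_two, mul_assoc]
    exact hφc.mul_right
  have iA : Integrable fun x => A x ^ 2 := by
    refine Continuous.integrable_of_hasCompactSupport (hAcont.pow 2) ?_
    simp only [pow_two]
    exact hAc.mul_right
  have iT : Integrable fun x => u x * lap n u x * gradDot φ φ x :=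
    ((hu.continuous.mul hL.continuous).mul hg.continuous).integrable_of_hasCompactSupport
      hgc.mul_left
  have iS : Integrable fun x => gradDot u u x * gradDot φ φ x :=
    ((contDiff_gradDot hu hu).continuous.mul hg.continuous).integrable_of_hasCompactSupport
      hgc.mul_left
  have iP : Integrable fun x => u x ^ 2 * lap n (gradDot φ φ) x :=
    ((hu.continuous.pow 2).mul (contDiff_lap hg).continuous).integrable_of_hasCompactSupport
      (hasCompactSupport_lap hg hgc).mul_left
  have iQ : Integrable fun x => lap n (fun x => u x * φ x) x ^ 2 := by
    refine Continuous.integrable_of_hasCompactSupport ((contDiff_lap huφ).continuous.pow 2) ?_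
    simp only [pow_two]
    exact (hasCompactSupport_lap huφ huφc).mul_right
  have iQ' : Integrable fun x => lap n u x * lap n (fun x => u x * φ x * φ x) x :=
    (hL.continuous.mul (contDiff_lap (huφ.mul hφ)).continuous).integrable_of_hasCompactSupport
      (hasCompactSupport_lap (huφ.mul hφ) hφc.mul_left).mul_left
  have stab : p * ∫ x, ‖x‖ ^ a * |u x| ^ (p + 1) * φ x ^ 2 ≤
      ∫ x, lap n (fun x => u x * φ x) x ^ 2 := by
    refine le_of_eq_of_le ?_ (hst _ huφ huφc (subset_univ _))
    congr 2
    funext x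
    rw [← abs_rpow_sub_one_mul_sq hp]
    ring
  have eqn : ∫ x, lap n u x * lap n (fun x => u x * φ x * φ x) x =
      ∫ x, ‖x‖ ^ a * |u x| ^ (p + 1) * φ x ^ 2 := by
    rw [integral_mul_lap hL (huφ.mul hφ) hφc.mul_left]
    congr 1
    funext x
    rw [hsol x (mem_univ x), ← abs_rpow_sub_one_mul_sq hp]
    ring
  have expand : ∫ x, lap n (fun x => u x * φ x) x ^ 2 =
      (∫ x, lap n u x * lap n (fun x => u x * φ x * φ x) x) + (∫ x, A x ^ 2) -
        2 * ∫ x, u x * lap n u x * gradDot φ φ x := by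
    rw [← integral_const_mul, ← integral_add iQ' iA,
      ← integral_sub (by exact iQ'.add iA) (iT.const_mul 2)]
    congr 1
    funext x
    rw [lap_mul huφ hφ, hlapuφ, gradDot_mul_left hu hφ]
    simp only [A]
    ring
  have green : (∫ x, u x ^ 2 * lap n (gradDot φ φ) x) =
      2 * (∫ x, gradDot u u x * gradDot φ φ x) +
        2 * ∫ x, u x * lap n u x * gradDot φ φ x := by
    rw [← integral_const_mul, ← integral_const_mul, ← integral_add (iS.const_mul 2)
      (iT.const_mul 2)]
    rw [integral_mul_lap (f := fun x => u x ^ 2) (hu.pow 2) hg hgc]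
    congr 1
    funext x
    have : (fun x => u x ^ 2) = fun x => u x * u x := by funext x; ring
    rw [this, lap_mul hu hu]
    ring
  have bP : (∫ x, u x ^ 2 * lap n (gradDot φ φ) x) ≤ K * ∫ x, u x ^ 2 * h x := by
    rw [← integral_const_mul]
    refine integral_mono iP (hint.const_mul K) fun x => ?_
    have := mul_le_mul_of_nonneg_left (h₃ x) (sq_nonneg (u x))
    simp only
    linarith
  have bA : (∫ x, A x ^ 2) ≤ 8 * (∫ x, gradDot u u x * gradDot φ φ x) +
      2 * K * ∫ x, u x ^ 2 * h x := by
    rw [← integral_const_mul, ← integral_const_mul,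
      ← integral_add (iS.const_mul 8) (hint.const_mul (2 * K))]
    refine integral_mono iA ((iS.const_mul 8).add (hint.const_mul (2 * K))) fun x => ?_
    have e₁ := mul_le_mul_of_nonneg_left (h₂ x) (sq_nonneg (u x))
    have e₂ := gradDot_sq_le (f := u) (g := φ) x
    simp only [A]
    nlinarith [sq_nonneg (2 * gradDot u φ x - u x * lap n φ x)]
  have bX : (∫ x, φ x ^ 2 * lap n u x ^ 2) ≤
      2 * (∫ x, lap n (fun x => u x * φ x) x ^ 2) + 2 * ∫ x, A x ^ 2 := by
    rw [← integral_const_mul, ← integral_const_mul,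
      ← integral_add (iQ.const_mul 2) (iA.const_mul 2)]
    refine integral_mono iX ((iQ.const_mul 2).add (iA.const_mul 2)) fun x => ?_
    simp only [A, hlapuφ]
    nlinarith [sq_nonneg (φ x * lap n u x + 2 * (2 * gradDot u φ x + u x * lap n φ x))]
  have bT : -(∫ x, u x * lap n u x * gradDot φ φ x) ≤
      1 / (20 * c) * (∫ x, φ x ^ 2 * lap n u x ^ 2) + 5 * c * K * ∫ x, u x ^ 2 * h x := by
    rw [← integral_const_mul, ← integral_const_mul, ← integral_neg,
      ← integral_add (iX.const_mul _) (hint.const_mul _)]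
    refine integral_mono iT.neg ((iX.const_mul _).add (hint.const_mul _)) fun x => ?_
    have hx := hh x
    refine (neg_le_abs _).trans (abs_le_of_sq_le_sq ?_ (by positivity))
    have e₁ := mul_le_mul_of_nonneg_left (h₁ x) (sq_nonneg (u x * lap n u x))
    calc (u x * lap n u x * gradDot φ φ x) ^ 2
        = (u x * lap n u x) ^ 2 * gradDot φ φ x ^ 2 := by ring
      _ ≤ (u x * lap n u x) ^ 2 * (K * φ x ^ 2 * h x) := e₁
      _ = 4 * (1 / (20 * c) * (φ x ^ 2 * lap n u x ^ 2)) * (5 * c * K * (u x ^ 2 * h x)) := by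
        field_simp
        ring
      _ ≤ _ := four_mul_le_sq_add _ _
  have hW0 : 0 ≤ ∫ x, ‖x‖ ^ a * |u x| ^ (p + 1) * φ x ^ 2 :=
    integral_nonneg fun x => by positivity
  have hX0 : 0 ≤ ∫ x, φ x ^ 2 * lap n u x ^ 2 := integral_nonneg fun x => by positivity
  have hY0 : 0 ≤ ∫ x, u x ^ 2 * h x :=
    integral_nonneg fun x => mul_nonneg (sq_nonneg _) (hh x)
  rw [eqn] at expand
  generalize (∫ x, ‖x‖ ^ a * |u x| ^ (p + 1) * φ x ^ 2) = W at *
  generalize (∫ x, φ x ^ 2 * lap n u x ^ 2) = X at *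
  generalize (∫ x, u x ^ 2 * h x) = Y at *
  generalize (∫ x, lap n (fun x => u x * φ x) x ^ 2) = Q at *
  generalize (∫ x, A x ^ 2) = J at *
  generalize (∫ x, u x * lap n u x * gradDot φ φ x) = T at *
  generalize (∫ x, gradDot u u x * gradDot φ φ x) = S at *
  generalize (∫ x, u x ^ 2 * lap n (gradDot φ φ) x) = P at *
  set Z := 1 / (20 * c) * X + 5 * c * K * Y with hZ
  have hZ0 : 0 ≤ Z := by positivity
  have hJ : J ≤ 6 * K * Y + 10 * Z := by linarith
  have hI : J - 2 * T ≤ 6 * K * Y + 10 * Z := by linarith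
  have hW : W ≤ (6 * K * Y + 10 * Z) / (p - 1) := by rw [le_div_iff₀ hp']; linarith
  have hc' : c * (6 * K * Y + 10 * Z) =
      3 * ((6 * K * Y + 10 * Z) / (p - 1)) + 4 * (6 * K * Y + 10 * Z) := by
    rw [hc]; field_simp; ring
  have hsum : X + W ≤ c * (6 * K * Y + 10 * Z) := by linarith
  have hcZ : c * (6 * K * Y + 10 * Z) = 6 * K * c * Y + X / 2 + 50 * c ^ 2 * K * Y := by
    rw [hZ]; field_simp; ring
  linarith

end Energy

section Scaling

variable {a p : ℝ}

/-- A weighted Young inequality, absorbing the quadratic term into the nonlinear one. -/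
lemma exists_young_bound (a : ℝ) (hp : 1 < p) {δ : ℝ} (hδ : 0 < δ) {k : ℕ}
    (hk : 4 ≤ k * (p - 1)) :
    ∃ C : ℝ, 0 ≤ C ∧ ∀ R v e w : ℝ, 0 < R → 0 ≤ e → e ≤ 1 → R ^ a ≤ w →
      v ^ 2 * (R⁻¹ ^ 4 * e ^ (2 * k)) ≤
        δ * (w * |v| ^ (p + 1) * (e ^ (k + 2)) ^ 2) +
          C * R ^ (-((4 * (p + 1) + 2 * a) / (p - 1))) := by
  have hp' : 0 < p - 1 := by linarith
  have hp1 : 0 < p + 1 := by linarith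
  set q := (p + 1) / 2 with hq
  set q' := (p + 1) / (p - 1) with hq'
  have hq1 : 1 < q := by rw [hq]; linarith
  have hq'1 : 1 < q' := by rw [hq', lt_div_iff₀ hp']; linarith
  have hq0 : 0 < q := by linarith
  have hconj : q.HolderConjugate q' := by
    rw [Real.holderConjugate_iff]
    refine ⟨hq1, ?_⟩
    rw [hq, hq']
    field_simp
    ring
  refine ⟨(δ ^ (-(1 / q))) ^ q', by positivity, fun R v e w hR he he1 hw => ?_⟩
  have key := Real.young_inequality_of_nonneg
    (a := δ ^ (1 / q) * (v ^ 2 * e ^ (2 * k) * R ^ (a / q)))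
    (b := δ ^ (-(1 / q)) * R ^ (-4 - a / q)) (by positivity) (by positivity) hconj
  have hleft : δ ^ (1 / q) * (v ^ 2 * e ^ (2 * k) * R ^ (a / q)) *
      (δ ^ (-(1 / q)) * R ^ (-4 - a / q)) = v ^ 2 * (R⁻¹ ^ 4 * e ^ (2 * k)) := by
    have e₁ : δ ^ (1 / q) * δ ^ (-(1 / q)) = 1 := by
      rw [← Real.rpow_add hδ]; simp
    have e₂ : R ^ (a / q) * R ^ (-4 - a / q) = R⁻¹ ^ 4 := by
      rw [← Real.rpow_add hR, show a / q + (-4 - a / q) = -((4 : ℕ) : ℝ) by push_cast; ring,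
        Real.rpow_neg hR.le, Real.rpow_natCast, inv_pow]
    calc _ = (δ ^ (1 / q) * δ ^ (-(1 / q))) * (v ^ 2 * e ^ (2 * k) *
          (R ^ (a / q) * R ^ (-4 - a / q))) := by ring
      _ = _ := by rw [e₁, e₂]; ring
  have hs : (δ ^ (1 / q) * (v ^ 2 * e ^ (2 * k) * R ^ (a / q))) ^ q ≤
      δ * (w * |v| ^ (p + 1) * (e ^ (k + 2)) ^ 2) := by
    rw [Real.mul_rpow (by positivity) (by positivity),
      Real.mul_rpow (by positivity) (by positivity),
      Real.mul_rpow (by positivity) (by positivity), ← Real.rpow_mul hδ.le,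
      ← Real.rpow_mul hR.le, one_div_mul_cancel hq0.ne', Real.rpow_one,
      div_mul_cancel₀ _ hq0.ne']
    have e₁ : (v ^ 2) ^ q = |v| ^ (p + 1) := by
      rw [← sq_abs, ← Real.rpow_natCast, ← Real.rpow_mul (abs_nonneg v)]
      congr 1
      rw [hq]; push_cast; ring
    have e₂ : (e ^ (2 * k)) ^ q ≤ (e ^ (k + 2)) ^ 2 := by
      rw [← pow_mul, ← Real.rpow_natCast, ← Real.rpow_natCast, ← Real.rpow_mul he]
      refine Real.rpow_le_rpow_of_exponent_ge' he he1 (by positivity) ?_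
      rw [hq]; push_cast; nlinarith
    rw [e₁]
    calc δ * (|v| ^ (p + 1) * (e ^ (2 * k)) ^ q * R ^ a)
        ≤ δ * (|v| ^ (p + 1) * (e ^ (k + 2)) ^ 2 * w) := by gcongr
      _ = _ := by ring
  have hb : (δ ^ (-(1 / q)) * R ^ (-4 - a / q)) ^ q' =
      (δ ^ (-(1 / q))) ^ q' * R ^ (-((4 * (p + 1) + 2 * a) / (p - 1))) := by
    rw [Real.mul_rpow (by positivity) (by positivity), ← Real.rpow_mul hR.le]
    congr 2
    rw [hq, hq']
    field_simp
    ring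
  rw [hleft, hb] at key
  refine key.trans (add_le_add ((div_le_self (by positivity) hq1.le).trans hs)
    (div_le_self (by positivity) hq'1.le))

/-- The energy estimate on balls whose surrounding annulus stays away from the origin. -/
lemma exists_energy_bound_of_annulus (n : ℕ) (ha : 0 ≤ a) (hp : 1 < p) :
    ∃ C : ℝ, 0 ≤ C ∧ ∀ u : EuclideanSpace ℝ (Fin n) → ℝ, ContDiff ℝ (⊤ : ℕ∞) u →
      IsSolutionOn n a p u Set.univ → StableOn n a p u Set.univ →
      ∀ (x : EuclideanSpace ℝ (Fin n)) (R : ℝ), 0 < R →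
        (∀ y ∉ ball x R, y ∈ closedBall x (2 * R) → R ≤ ‖y‖) →
        (∫ y in ball x R, lap n u y ^ 2 + ‖y‖ ^ a * |u y| ^ (p + 1)) ≤
          C * R ^ ((n : ℝ) - (4 * (p + 1) + 2 * a) / (p - 1)) := by
  have hp' : 0 < p - 1 := by linarith
  obtain ⟨k, hk⟩ := exists_nat_ge (4 / (p - 1))
  rw [div_le_iff₀ hp'] at hk
  have hk0 : k ≠ 0 := by
    rintro rfl
    norm_num at hk
  obtain ⟨η, K, hK, hη, hη0, hη1, hηone, hηzero, b₁, b₂, b₃⟩ := exists_cutoff n k hk0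
  obtain ⟨c, hc⟩ : ∃ c, c = (2 * p + 1) / (p - 1) + 2 := ⟨_, rfl⟩
  have hc0 : 0 < c := by rw [hc]; positivity
  obtain ⟨B, hB⟩ : ∃ B, B = 12 * K * c + 100 * c ^ 2 * K := ⟨_, rfl⟩
  have hB0 : 0 < B := by rw [hB]; positivity
  obtain ⟨D, hD0, hD⟩ :=
    exists_young_bound a hp (δ := 1 / (2 * B)) (by positivity) hk
  set θ := (4 * (p + 1) + 2 * a) / (p - 1) with hθ
  refine ⟨2 * B * D * (2 ^ n * (volume : Measure (EuclideanSpace ℝ (Fin n))).real (ball 0 1)),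
    by positivity, fun u hu hsol hst x R hR hann => ?_⟩
  let T : EuclideanSpace ℝ (Fin n) → EuclideanSpace ℝ (Fin n) := fun y => R⁻¹ • (y - x)
  have hT : Continuous T := by fun_prop
  have hTnorm : ∀ y, ‖T y‖ = R⁻¹ * dist y x := fun y => by
    simp only [T, norm_smul, norm_inv, Real.norm_eq_abs, abs_of_pos hR, dist_eq_norm]
  have hTball : ∀ y ∈ ball x R, T y ∈ ball 0 1 := fun y hy => by
    rw [mem_ball_zero_iff, hTnorm, inv_mul_lt_iff₀ hR, mul_one]
    exact hy
  have hTout : ∀ y ∉ closedBall x (2 * R), T y ∉ closedBall 0 2 := fun y hy => by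
    rw [mem_closedBall, not_le] at hy
    rw [mem_closedBall_zero_iff, hTnorm, not_le, lt_inv_mul_iff₀ hR]
    linarith
  let φ₀ : EuclideanSpace ℝ (Fin n) → ℝ := fun y => η y ^ (k + 2)
  have hφ₀ : ContDiff ℝ (⊤ : ℕ∞) φ₀ := hη.pow _
  let φ : EuclideanSpace ℝ (Fin n) → ℝ := fun y => φ₀ (R⁻¹ • (y - x))
  have hφ : ContDiff ℝ (⊤ : ℕ∞) φ := contDiff_comp_affine hφ₀ _ _
  have hφzero : ∀ y ∉ closedBall x (2 * R), φ y = 0 := fun y hy => by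
    have : η (R⁻¹ • (y - x)) = 0 := hηzero _ (hTout y hy)
    simp [φ, φ₀, this]
  have hφc : HasCompactSupport φ :=
    HasCompactSupport.intro (isCompact_closedBall x (2 * R)) hφzero
  have hφone : ∀ y ∈ ball x R, φ y = 1 := fun y hy => by
    have : η (R⁻¹ • (y - x)) = 1 := hηone _ (hTball y hy)
    simp [φ, φ₀, this]
  have hφev : ∀ y ∈ ball x R, φ =ᶠ[𝓝 y] fun _ => 1 := fun y hy => by
    filter_upwards [isOpen_ball.mem_nhds hy] with z hz using hφone z hz
  let h₀ : EuclideanSpace ℝ (Fin n) → ℝ := fun y => R⁻¹ ^ 4 * η (T y) ^ (2 * k)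
  let h : EuclideanSpace ℝ (Fin n) → ℝ := (ball x R)ᶜ.indicator h₀
  have hh₀ : ∀ y, 0 ≤ h₀ y := fun y => mul_nonneg (by positivity) (pow_nonneg (hη0 _) _)
  have hh : ∀ y, 0 ≤ h y := fun y => indicator_nonneg (fun z _ => hh₀ z) y
  have hh_in : ∀ y ∈ ball x R, h y = 0 := fun y hy =>
    indicator_of_notMem (by simpa using hy) _
  have hh_out : ∀ y ∉ ball x R, h y = h₀ y := fun y hy => indicator_of_mem hy _
  have hint : Integrable fun y => u y ^ 2 * h y := by
    have i₀ : Integrable fun y => u y ^ 2 * h₀ y := by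
      refine Continuous.integrable_of_hasCompactSupport ((hu.continuous.pow 2).mul
        (continuous_const.mul ((hη.continuous.comp hT).pow _))) ?_
      refine HasCompactSupport.intro (isCompact_closedBall x (2 * R)) fun y hy => ?_
      simp [h₀, hηzero _ (hTout y hy), hk0]
    refine (i₀.indicator (measurableSet_ball (x := x) (ε := R)).compl).congr
      (Eventually.of_forall fun y => Eq.symm ?_)
    simp only
    by_cases hy : y ∈ ball x R
    · rw [hh_in y hy, indicator_of_notMem (by simpa using hy), mul_zero]
    · rw [hh_out y hy, indicator_of_mem (by exact hy)]
  have hgφ : gradDot φ φ = fun y => R⁻¹ ^ 2 * gradDot φ₀ φ₀ (R⁻¹ • (y - x)) :=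
    gradDot_comp_affine hφ₀ hφ₀ _ _
  have hg₀ := contDiff_gradDot hφ₀ hφ₀
  have hR4 : 0 ≤ R⁻¹ ^ 4 := by positivity
  have energy := energy_le_integral_sq_mul hp hK hu hsol hst hφ hφc hh hint
    (fun y => by
      by_cases hy : y ∈ ball x R
      · rw [(gradDot_eventuallyEq_zero (hφev y hy)).eq_of_nhds, hh_in y hy]
        simp
      · rw [hh_out y hy, hgφ]
        have := mul_le_mul_of_nonneg_left (b₁ (T y)) hR4
        calc _ = R⁻¹ ^ 4 * gradDot φ₀ φ₀ (T y) ^ 2 := by ring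
          _ ≤ _ := this
          _ = K * φ y ^ 2 * h₀ y := by simp only [h₀, φ, φ₀, T]; ring)
    (fun y => by
      by_cases hy : y ∈ ball x R
      · rw [lap_eq_zero_of_eventuallyEq hφ (hφev y hy), hh_in y hy]
        simp
      · rw [hh_out y hy, lap_comp_affine hφ₀]
        have := mul_le_mul_of_nonneg_left (b₂ (T y)) hR4
        calc _ = R⁻¹ ^ 4 * lap n φ₀ (T y) ^ 2 := by ring
          _ ≤ _ := this
          _ = K * h₀ y := by simp only [h₀]; ring)
    (fun y => by
      by_cases hy : y ∈ ball x R
      · rw [lap_eq_zero_of_eventuallyEq (contDiff_gradDot hφ hφ)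
          (gradDot_eventuallyEq_zero (hφev y hy)), hh_in y hy]
        simp
      · rw [hh_out y hy, hgφ, lap_const_mul (contDiff_comp_affine hg₀ _ _),
          lap_comp_affine hg₀]
        have := mul_le_mul_of_nonneg_left (b₃ (T y)) hR4
        calc _ = R⁻¹ ^ 4 * lap n (gradDot φ₀ φ₀) (T y) := by ring
          _ ≤ _ := this
          _ = K * h₀ y := by simp only [h₀]; ring) hc
  rw [← hB] at energy
  have cW : Continuous fun y => ‖y‖ ^ a * |u y| ^ (p + 1) :=
    (continuous_norm.rpow_const fun _ => Or.inr ha).mul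
      (hu.continuous.abs.rpow_const fun _ => Or.inr (by linarith))
  have iW : Integrable fun y => ‖y‖ ^ a * |u y| ^ (p + 1) * φ y ^ 2 := by
    refine (cW.mul (hφ.continuous.pow 2)).integrable_of_hasCompactSupport ?_
    refine HasCompactSupport.intro (isCompact_closedBall x (2 * R)) fun y hy => ?_
    simp [hφzero y hy]
  have iX : Integrable fun y => φ y ^ 2 * lap n u y ^ 2 := by
    refine ((hφ.continuous.pow 2).mul
      ((contDiff_lap hu).continuous.pow 2)).integrable_of_hasCompactSupport ?_
    refine HasCompactSupport.intro (isCompact_closedBall x (2 * R)) fun y hy => ?_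
    simp [hφzero y hy]
  have hY : (∫ y, u y ^ 2 * h y) ≤
      1 / (2 * B) * (∫ y, ‖y‖ ^ a * |u y| ^ (p + 1) * φ y ^ 2) +
        D * R ^ (-θ) * volume.real (closedBall x (2 * R)) := by
    have iC : Integrable ((closedBall x (2 * R)).indicator fun _ => D * R ^ (-θ)) := by
      rw [integrable_indicator_iff measurableSet_closedBall]
      exact integrableOn_const measure_closedBall_lt_top.ne
    have hC : ∫ y, (closedBall x (2 * R)).indicator (fun _ => D * R ^ (-θ)) y =
        D * R ^ (-θ) * volume.real (closedBall x (2 * R)) := by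
      rw [integral_indicator measurableSet_closedBall, setIntegral_const, smul_eq_mul, mul_comm]
    rw [← hC, ← integral_const_mul, ← integral_add (iW.const_mul _) iC]
    refine integral_mono hint ((iW.const_mul _).add iC) fun y => ?_
    have hnn : 0 ≤ 1 / (2 * B) * (‖y‖ ^ a * |u y| ^ (p + 1) * φ y ^ 2) := by positivity
    have hnn' : 0 ≤ (closedBall x (2 * R)).indicator (fun _ => D * R ^ (-θ)) y :=
      indicator_nonneg (fun _ _ => by positivity) y
    by_cases hy : y ∈ ball x R
    · simp only [hh_in y hy, mul_zero]
      exact add_nonneg hnn hnn'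
    · by_cases hy' : y ∈ closedBall x (2 * R)
      · simp only [hh_out y hy, indicator_of_mem hy']
        exact hD R (u y) (η (T y)) (‖y‖ ^ a) hR (hη0 _) (hη1 _)
          (Real.rpow_le_rpow hR.le (hann y hy hy') ha)
      · simp only [hh_out y hy, h₀, hηzero _ (hTout y hy')]
        rw [zero_pow (by omega), mul_zero, mul_zero]
        exact add_nonneg hnn hnn'
  have hball : (∫ y in ball x R, lap n u y ^ 2 + ‖y‖ ^ a * |u y| ^ (p + 1)) ≤
      (∫ y, φ y ^ 2 * lap n u y ^ 2) + ∫ y, ‖y‖ ^ a * |u y| ^ (p + 1) * φ y ^ 2 := by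
    rw [← integral_add iX iW]
    refine le_of_eq_of_le (setIntegral_congr_fun measurableSet_ball fun y hy => ?_)
      (setIntegral_le_integral (iX.add iW) (Eventually.of_forall fun y => ?_))
    · simp [hφone y hy]
    · simp only [Pi.zero_apply]
      positivity
  have hX0 : 0 ≤ ∫ y, φ y ^ 2 * lap n u y ^ 2 := integral_nonneg fun y => by positivity
  have hW0 : 0 ≤ ∫ y, ‖y‖ ^ a * |u y| ^ (p + 1) * φ y ^ 2 :=
    integral_nonneg fun y => by positivity
  have hvol : volume.real (closedBall x (2 * R)) =
      2 ^ n * (volume : Measure (EuclideanSpace ℝ (Fin n))).real (ball 0 1) * R ^ n := by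
    rw [Measure.addHaar_real_closedBall _ _ (by positivity), finrank_euclideanSpace_fin]
    ring
  have hpow : R ^ ((n : ℝ) - θ) = R ^ n * R ^ (-θ) := by
    rw [sub_eq_add_neg, Real.rpow_add hR, Real.rpow_natCast]
  have hBY := mul_le_mul_of_nonneg_left hY hB0.le
  rw [hvol] at hBY
  rw [hpow]
  have hhalf : ∀ W : ℝ, B * (1 / (2 * B) * W) = W / 2 := fun W => by field_simp
  rw [mul_add, hhalf] at hBY
  nlinarith

end Scaling

/-- Lemma 2.2, estimate (2.17): scaling-invariant energy estimate
for smooth stable solutions. -/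
theorem stmt8 (n : ℕ) (hn : 5 ≤ n) (a p : ℝ) (ha : 0 ≤ a) (hp : 1 < p) :
    ∃ C : ℝ, 0 < C ∧
      ∀ u : EuclideanSpace ℝ (Fin n) → ℝ, ContDiff ℝ (⊤ : ℕ∞) u →
        IsSolutionOn n a p u Set.univ → StableOn n a p u Set.univ →
        ∀ (x : EuclideanSpace ℝ (Fin n)) (R : ℝ), 0 < R →
          (∫ y in ball x R, lap n u y ^ 2 + ‖y‖ ^ a * |u y| ^ (p + 1)) ≤
            C * R ^ ((n : ℝ) - (4 * (p + 1) + 2 * a) / (p - 1)) := by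
  obtain ⟨C, hC, H⟩ := exists_energy_bound_of_annulus n ha hp
  set e := (n : ℝ) - (4 * (p + 1) + 2 * a) / (p - 1) with he
  have h5 : (0 : ℝ) < 5 ^ e := by positivity
  refine ⟨C + C * 5 ^ e + 1, by positivity, fun u hu hsol hst x R hR => ?_⟩
  have hRe : 0 < R ^ e := by positivity
  by_cases hx : 4 * R ≤ ‖x‖
  · refine (H u hu hsol hst x R hR fun y _ hy => ?_).trans ?_
    · rw [mem_closedBall, dist_comm, dist_eq_norm] at hy
      have := norm_sub_norm_le x y
      linarith
    · have : 0 ≤ C * 5 ^ e := by positivity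
      exact mul_le_mul_of_nonneg_right (by linarith) hRe.le
  · rw [not_le] at hx
    have hcont : Continuous fun y => lap n u y ^ 2 + ‖y‖ ^ a * |u y| ^ (p + 1) :=
      ((contDiff_lap hu).continuous.pow 2).add
        ((continuous_norm.rpow_const fun _ => Or.inr ha).mul
          (hu.continuous.abs.rpow_const fun _ => Or.inr (by linarith)))
    have hsub : ball x R ⊆ ball 0 (5 * R) := ball_subset_ball' (by
      rw [dist_zero_right]
      linarith)
    calc (∫ y in ball x R, lap n u y ^ 2 + ‖y‖ ^ a * |u y| ^ (p + 1))
        ≤ ∫ y in ball 0 (5 * R), lap n u y ^ 2 + ‖y‖ ^ a * |u y| ^ (p + 1) :=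
          setIntegral_mono_set
            ((hcont.continuousOn.integrableOn_compact
              (isCompact_closedBall 0 (5 * R))).mono_set ball_subset_closedBall)
            (Eventually.of_forall fun y => by
              simp only [Pi.zero_apply]
              positivity)
            (Eventually.of_forall hsub)
      _ ≤ C * (5 * R) ^ e := H u hu hsol hst 0 (5 * R) (by positivity) fun y hy _ => by
          simpa using hy
      _ = C * 5 ^ e * R ^ e := by
          rw [Real.mul_rpow (by norm_num) hR.le, mul_assoc]
      _ ≤ _ := mul_le_mul_of_nonneg_right (by linarith) hRe.le
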